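/- arXiv:2401.13435 — 5 statements merged into one kernel-verified Lean document; each statement's English description precedes it below -/
import Mathlib

section
/- Let n ≥ 1 and let G be a real symmetric 2n × 2n matrix. Then the value max(0, λ_max(iJ_{2n} − G)) is the least element of the set {‖G − H‖ : H a real symmetric 2n × 2n matrix with H ≥ iJ_{2n}}, where ‖·‖ is the operator norm; moreover this minimum is attained at H = G + max(0, λ_max(iJ_{2n} − G))·I_{2n}. In other words, the closest (in operator norm) quantum covariance matrix to G is at distance max(0, λ_max(iJ_{2n} − G)) from G. -/
open Matrix ComplexOrder

noncomputable section

/-- The standard symplectic form matrix `J_{2n}`: block-diagonal with `n` blocks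
`[[0,1],[-1,0]]`. -/
def Jmat (n : ℕ) : Matrix (Fin (2 * n)) (Fin (2 * n)) ℝ :=
  Matrix.of fun i j =>
    if i.val % 2 = 0 ∧ (j : ℕ) = (i : ℕ) + 1 then 1
    else if j.val % 2 = 0 ∧ (i : ℕ) = (j : ℕ) + 1 then -1
    else 0

/-- Complexification of a real matrix. -/
def toC {d : ℕ} (A : Matrix (Fin d) (Fin d) ℝ) : Matrix (Fin d) (Fin d) ℂ :=
  A.map (fun x => (x : ℂ))

/-- The largest (real) eigenvalue of a complex (Hermitian) matrix, as the supremum of the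
real points of its spectrum. -/
def lmax {d : ℕ} (M : Matrix (Fin d) (Fin d) ℂ) : ℝ :=
  sSup {x : ℝ | (x : ℂ) ∈ spectrum ℂ M}

/-- The operator norm (largest singular value) of a real matrix. -/
def opNorm {d : ℕ} (A : Matrix (Fin d) (Fin d) ℝ) : ℝ :=
  ‖Matrix.toEuclideanCLM (𝕜 := ℝ) (n := Fin d) A‖

lemma toC_add {d : ℕ} (A B : Matrix (Fin d) (Fin d) ℝ) : toC (A + B) = toC A + toC B := by
  ext i j; simp [toC]

lemma toC_sub {d : ℕ} (A B : Matrix (Fin d) (Fin d) ℝ) : toC (A - B) = toC A - toC B := by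
  ext i j; simp [toC]

lemma toC_smul_one {d : ℕ} (c : ℝ) :
    toC (c • (1 : Matrix (Fin d) (Fin d) ℝ)) = (c : ℂ) • 1 := by
  ext i j; by_cases h : i = j <;> simp [toC, h]

lemma toC_psd {d : ℕ} {A : Matrix (Fin d) (Fin d) ℝ} (hA : A.PosSemidef) :
    (toC A).PosSemidef := by
  have h : ∃ B : Matrix (Fin d) (Fin d) ℝ, A = Bᴴ * B := by
    open scoped MatrixOrder in
    exact CStarAlgebra.nonneg_iff_eq_star_mul_self.mp hA.nonneg
  obtain ⟨B, rfl⟩ := h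
  have : toC (Bᴴ * B) = (toC B)ᴴ * toC B := by
    ext i j; simp [toC, Matrix.mul_apply]
  rw [this]
  exact posSemidef_conjTranspose_mul_self _

lemma toC_herm {d : ℕ} {A : Matrix (Fin d) (Fin d) ℝ} (hA : A.IsSymm) :
    (toC A).IsHermitian := by
  ext i j
  simp [toC, hA.apply]

lemma IJ_herm (n : ℕ) : (Complex.I • toC (Jmat n)).IsHermitian := by
  have h : ∀ i j, Jmat n j i = - Jmat n i j := by
    intro i j
    simp only [Jmat, Matrix.of_apply]
    split_ifs <;> first | (exfalso; omega) | norm_num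
  ext i j
  simp [toC, h i j]

lemma mem_spec_sub {d : ℕ} (M : Matrix (Fin d) (Fin d) ℂ) (r x : ℂ) :
    x ∈ spectrum ℂ (r • 1 - M) ↔ r - x ∈ spectrum ℂ M := by
  rw [← Algebra.algebraMap_eq_smul_one, ← spectrum.singleton_sub_eq]
  simp only [Set.singleton_sub, Set.mem_image]
  constructor
  · rintro ⟨y, hy, rfl⟩; simpa using hy
  · intro h; exact ⟨_, h, by ring⟩

lemma lmax_psd {d : ℕ} {M : Matrix (Fin d) (Fin d) ℂ} (hM : M.IsHermitian) {r : ℝ}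
    (hr : lmax M ≤ r) : ((r : ℂ) • 1 - M).PosSemidef := by
  have hH : ((r : ℂ) • 1 - M).IsHermitian := by
    refine IsHermitian.sub ?_ hM
    ext i j; by_cases h : i = j <;> simp [h, Matrix.one_apply, eq_comm]
  rw [hH.posSemidef_iff_eigenvalues_nonneg]
  intro i
  have h1 : ((hH.eigenvalues i : ℝ) : ℂ) ∈ spectrum ℂ ((r : ℂ) • 1 - M) := by
    have := hH.eigenvalues_mem_spectrum_real i
    rw [← spectrum.preimage_algebraMap ℂ] at this
    exact this
  rw [mem_spec_sub] at h1
  have hb : BddAbove {x : ℝ | (x : ℂ) ∈ spectrum ℂ M} :=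
    (M.finite_spectrum.preimage Complex.ofReal_injective.injOn).bddAbove
  have h2 : r - hH.eigenvalues i ≤ lmax M := le_csSup hb (by simpa using h1)
  simp only [Pi.zero_apply]
  linarith

lemma lmax_le {d : ℕ} {M : Matrix (Fin d) (Fin d) ℂ} {r : ℝ} (hr : 0 ≤ r)
    (h : ((r : ℂ) • 1 - M).PosSemidef) : lmax M ≤ r := by
  refine Real.sSup_le ?_ hr
  intro x hx
  have h1 : ((r - x : ℝ) : ℂ) ∈ spectrum ℂ ((r : ℂ) • 1 - M) := by
    rw [mem_spec_sub]; simpa using hx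
  have h2 := (posSemidef_iff_isHermitian_and_spectrum_nonneg.mp h).2 h1
  have h3 : (0 : ℂ) ≤ ((r - x : ℝ) : ℂ) := h2
  have h4 : 0 ≤ r - x := by exact_mod_cast h3
  linarith

lemma opNorm_psd {d : ℕ} {A : Matrix (Fin d) (Fin d) ℝ} (hA : A.IsSymm) :
    ((opNorm A) • 1 + A).PosSemidef := by
  refine PosSemidef.of_dotProduct_mulVec_nonneg ?_ ?_
  · ext i j; by_cases h : i = j <;> simp [h, Matrix.one_apply, eq_comm, hA.apply]
  · intro x
    have h1 := inner_toEuclideanCLM A (WithLp.toLp 2 x) (WithLp.toLp 2 x)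
    have h2 := abs_real_inner_le_norm (WithLp.toLp 2 x)
      (toEuclideanCLM (𝕜 := ℝ) A (WithLp.toLp 2 x))
    have h3 := (toEuclideanCLM (𝕜 := ℝ) A).le_opNorm (WithLp.toLp 2 x)
    have h4 : x ⬝ᵥ x = ‖WithLp.toLp 2 x‖ ^ 2 := by
      rw [EuclideanSpace.norm_sq_eq]; simp [dotProduct, sq]
    rw [h1] at h2
    have h5 := neg_le_of_abs_le h2
    simp only [star_trivial, add_mulVec, smul_mulVec, one_mulVec, dotProduct_add,
      dotProduct_smul, smul_eq_mul, h4]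
    have h6 := mul_le_mul_of_nonneg_left h3 (norm_nonneg (WithLp.toLp 2 x))
    unfold opNorm
    simp only at h5
    nlinarith

lemma opNorm_smul_one {n : ℕ} (hn : 1 ≤ n) (G : Matrix (Fin (2 * n)) (Fin (2 * n)) ℝ)
    {c : ℝ} (hc : 0 ≤ c) : opNorm (G - (G + c • 1)) = c := by
  have : Nonempty (Fin (2 * n)) := ⟨⟨0, by omega⟩⟩
  have e : G - (G + c • 1) = -(c • 1) := by abel
  unfold opNorm
  rw [e, map_neg, norm_neg, map_smul, map_one, norm_smul, norm_one, mul_one, Real.norm_of_nonneg hc]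

/-- The closest (in operator norm) quantum covariance matrix to a real symmetric matrix `G` is
at distance `max 0 (λ_max(iJ₂ₙ - G))` from `G`, the minimum being attained at
`H = G + max 0 (λ_max(iJ₂ₙ - G)) • I`. -/
theorem closest_quantum_covariance_matrix (n : ℕ) (hn : 1 ≤ n)
    (G : Matrix (Fin (2 * n)) (Fin (2 * n)) ℝ) (hG : G.IsSymm) :
    IsLeast
      {r : ℝ | ∃ H : Matrix (Fin (2 * n)) (Fin (2 * n)) ℝ,
        H.IsSymm ∧ (toC H - Complex.I • toC (Jmat n)).PosSemidef ∧ r = opNorm (G - H)}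
      (max 0 (lmax (Complex.I • toC (Jmat n) - toC G))) ∧
    (G + (max 0 (lmax (Complex.I • toC (Jmat n) - toC G))) •
        (1 : Matrix (Fin (2 * n)) (Fin (2 * n)) ℝ)).IsSymm ∧
    (toC (G + (max 0 (lmax (Complex.I • toC (Jmat n) - toC G))) • 1)
      - Complex.I • toC (Jmat n)).PosSemidef ∧
    opNorm (G - (G + (max 0 (lmax (Complex.I • toC (Jmat n) - toC G))) • 1)) =
      max 0 (lmax (Complex.I • toC (Jmat n) - toC G)) := by
  set M := Complex.I • toC (Jmat n) - toC G with hMdef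
  set c := max 0 (lmax M) with hc
  have hM : M.IsHermitian := (IJ_herm n).sub (toC_herm hG)
  have hsym : (G + c • (1 : Matrix (Fin (2 * n)) (Fin (2 * n)) ℝ)).IsSymm :=
    hG.add (isSymm_one.smul c)
  have hpsd : (toC (G + c • 1) - Complex.I • toC (Jmat n)).PosSemidef := by
    have := lmax_psd hM (le_max_right 0 (lmax M))
    rw [← hc] at this
    convert this using 1
    rw [toC_add, toC_smul_one, hMdef]
    abel
  have hno : opNorm (G - (G + c • 1)) = c := opNorm_smul_one hn G (le_max_left _ _)
  refine ⟨⟨⟨_, hsym, hpsd, hno.symm⟩, ?_⟩, hsym, hpsd, hno⟩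
  rintro r ⟨H, hH, hHp, rfl⟩
  have h0 : 0 ≤ opNorm (G - H) := norm_nonneg _
  refine max_le h0 (lmax_le h0 ?_)
  have h1 := (toC_psd (opNorm_psd (hG.sub hH))).add hHp
  convert h1 using 1
  rw [toC_add, toC_smul_one, toC_sub, hMdef]
  abel
end
end

section
/- As σ → ∞, the function R satisfies R(σ) = 2σ + 1/σ − 5/(4σ³) + O(σ⁻⁵); that is, there exist constants C > 0 and σ₀ > 0 such that |R(σ) − 2σ − 1/σ + 5/(4σ³)| ≤ C·σ⁻⁵ for all σ ≥ σ₀. -/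
noncomputable section

/-- The right edge `R(σ)` of the support of `(½δ₋₁ + ½δ₁) ⊞ SC_σ`. -/
def Redge (σ : ℝ) : ℝ :=
  (1 + σ / 4 * (Real.sqrt (8 + σ ^ 2) - σ)) *
    Real.sqrt (1 + σ / 2 * (Real.sqrt (8 + σ ^ 2) + σ))

/-- As `σ → ∞`, `R(σ) = 2σ + 1/σ - 5/(4σ³) + O(σ⁻⁵)`. -/
theorem Redge_asymptotics_at_infinity :
    ∃ C > (0 : ℝ), ∃ σ₀ > (0 : ℝ), ∀ σ : ℝ, σ₀ ≤ σ →
      |Redge σ - 2 * σ - 1 / σ + 5 / (4 * σ ^ 3)| ≤ C / σ ^ 5 := by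
  refine ⟨64, by norm_num, 4, by norm_num, ?_⟩
  intro σ hσ
  have hσ0 : 0 < σ := by linarith
  set w := Real.sqrt (8 + σ ^ 2) with hw
  have hw2 : w ^ 2 = 8 + σ ^ 2 := Real.sq_sqrt (by positivity)
  have hw0 : 0 ≤ w := Real.sqrt_nonneg _
  have hwσ : σ ≤ w := by nlinarith
  obtain ⟨t, ht⟩ : ∃ t, w = σ * (1 + t) := ⟨w / σ - 1, by field_simp; ring⟩
  have ht0 : 0 ≤ t := by
    by_contra h
    push Not at h
    nlinarith
  have hx : σ ^ 2 * (t * (t + 2)) = 8 := by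
    rw [ht] at hw2
    linarith
  obtain ⟨x, hxd⟩ : ∃ x, x = 1 / σ ^ 2 := ⟨_, rfl⟩
  have hxs : σ ^ 2 * x = 1 := by rw [hxd]; field_simp
  have hxt : x = t * (t + 2) / 8 := by
    have h1 : σ ^ 2 * (x - t * (t + 2) / 8) = 0 := by linarith
    rcases mul_eq_zero.mp h1 with h | h
    · exact absurd h (by positivity)
    · linarith
  have hx0 : 0 < x := by rw [hxd]; positivity
  have hx1 : x ≤ 1 / 16 := by
    have h16 : 16 ≤ σ ^ 2 := by nlinarith only [hσ]
    nlinarith only [h16, hxs, hx0]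
  have ht4 : t ≤ 4 * x := by nlinarith only [hxt, ht0, sq_nonneg t]
  have ht1 : t ≤ 1 := by linarith
  set A := 1 + σ / 4 * (w - σ) with hA
  have hA' : A * (t + 2) = t + 4 := by
    rw [hA, ht]; linear_combination hx / 4
  have hA0 : 0 ≤ A := by
    rw [hA]
    have : 0 ≤ w - σ := by linarith
    positivity
  set B := 1 + σ / 2 * (w + σ) with hB
  have hB0 : 0 ≤ B := by rw [hB]; positivity
  have hB' : B = σ ^ 2 * ((t + 2) * (t + 4) / 8) := by
    rw [hB, ht]; linear_combination -hx / 8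
  have hR : Redge σ = A * Real.sqrt B := rfl
  have hR0 : 0 ≤ Redge σ := by rw [hR]; positivity
  have hR2 : Redge σ ^ 2 * (t + 2) = σ ^ 2 * ((t + 4) ^ 3 / 8) := by
    rw [hR, mul_pow, Real.sq_sqrt hB0, hB']
    linear_combination σ ^ 2 * (t + 4) / 8 * (A * (t + 2) + (t + 4)) * hA'
  obtain ⟨T, hT⟩ : ∃ T, T = 2 + x - 5 / 4 * x ^ 2 := ⟨_, rfl⟩
  have hT1 : 1 ≤ T := by rw [hT]; nlinarith only [hx0, hx1]
  have hD : Redge σ - 2 * σ - 1 / σ + 5 / (4 * σ ^ 3) = Redge σ - σ * T := by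
    rw [hT, hxd]; field_simp; ring
  obtain ⟨Q, hQ⟩ : ∃ Q, Q = 29/64 + 1063/2048 * t + 611/4096 * t^2 + 35/4096 * t^3
    - 85/8192 * t^4 - 125/32768 * t^5 - 25/65536 * t^6 := ⟨_, rfl⟩
  have hQb : |Q| ≤ 2 := by
    have h2 : t ^ 2 ≤ 1 := pow_le_one₀ ht0 ht1
    have h3 : t ^ 3 ≤ 1 := pow_le_one₀ ht0 ht1
    have h4 : t ^ 4 ≤ 1 := pow_le_one₀ ht0 ht1
    have h5 : t ^ 5 ≤ 1 := pow_le_one₀ ht0 ht1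
    have h6 : t ^ 6 ≤ 1 := pow_le_one₀ ht0 ht1
    have k2 : 0 ≤ t ^ 2 := by positivity
    have k3 : 0 ≤ t ^ 3 := by positivity
    have k4 : 0 ≤ t ^ 4 := by positivity
    have k5 : 0 ≤ t ^ 5 := by positivity
    have k6 : 0 ≤ t ^ 6 := by positivity
    rw [abs_le, hQ]
    constructor <;> linarith
  have key : (Redge σ - σ * T) * ((Redge σ + σ * T) * (t + 2)) = σ ^ 2 * (t ^ 3 * Q) := by
    have h : (t + 4) ^ 3 / 8 - (t + 2) * T ^ 2 = t ^ 3 * Q := by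
      rw [hT, hQ, hxt]; ring
    linear_combination hR2 + σ ^ 2 * h
  have hden : 2 * σ ≤ (Redge σ + σ * T) * (t + 2) := by
    have h1 : σ ≤ Redge σ + σ * T := by
      have := mul_le_mul_of_nonneg_left hT1 hσ0.le
      linarith only [this, hR0]
    have h2 := mul_nonneg (hσ0.le.trans h1) ht0
    linarith only [h1, h2]
  have ht3 : t ^ 3 ≤ 64 * x ^ 3 := by
    calc t ^ 3 ≤ (4 * x) ^ 3 := pow_le_pow_left₀ ht0 ht4 3
      _ = 64 * x ^ 3 := by ring
  have habs : |Redge σ - σ * T| * ((Redge σ + σ * T) * (t + 2)) = σ ^ 2 * (t ^ 3 * |Q|) := by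
    have h := congrArg abs key
    rw [abs_mul, abs_of_nonneg (by linarith : 0 ≤ (Redge σ + σ * T) * (t + 2)), abs_mul,
      abs_mul, abs_of_nonneg (by positivity : 0 ≤ σ ^ 2),
      abs_of_nonneg (by positivity : 0 ≤ t ^ 3)] at h
    exact h
  have hfin : |Redge σ - σ * T| * (2 * σ) ≤ σ ^ 2 * (64 * x ^ 3 * 2) := by
    calc |Redge σ - σ * T| * (2 * σ)
        ≤ |Redge σ - σ * T| * ((Redge σ + σ * T) * (t + 2)) := by gcongr
      _ = σ ^ 2 * (t ^ 3 * |Q|) := habs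
      _ ≤ σ ^ 2 * (64 * x ^ 3 * 2) := by gcongr
  rw [hD]
  have he : σ ^ 2 * (64 * x ^ 3 * 2) = 64 / σ ^ 5 * (2 * σ) := by
    rw [hxd]; field_simp
  rw [he] at hfin
  exact le_of_mul_le_mul_right hfin (by positivity)
end
end

section
/- As σ → 0⁺, √(F(σ)) = 1 + 2√2·σ + o(σ); that is, (√(F(σ)) − 1 − 2√2·σ)/σ → 0 as σ → 0⁺. -/
noncomputable section

/-- `F(σ)`: the square of the right edge of the support of the limiting symplectic eigenvalue
distribution of a random quantum covariance matrix of parameter `σ`. -/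
def Fedge (σ : ℝ) : ℝ :=
  1 / 2 - σ ^ 4 / 8 + 4 * σ ^ 2 + σ * Real.sqrt (σ ^ 2 + 8) +
    σ ^ 3 / 8 * Real.sqrt (σ ^ 2 + 8) +
    1 / 64 * Real.sqrt (-4096 * σ ^ 6 + 78336 * σ ^ 4 + 49152 * σ ^ 2 +
      4096 * Real.sqrt (σ ^ 2 + 8) * σ + 4096 * Real.sqrt (σ ^ 2 + 8) * σ ^ 5 +
      33280 * Real.sqrt (σ ^ 2 + 8) * σ ^ 3 + 1024)

/-- As `σ → 0⁺`, `√(F(σ)) = 1 + 2√2·σ + o(σ)`. -/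
theorem sqrt_Fedge_asymptotics_at_zero :
    Filter.Tendsto (fun σ : ℝ => (Real.sqrt (Fedge σ) - 1 - 2 * Real.sqrt 2 * σ) / σ)
      (nhdsWithin 0 (Set.Ioi 0)) (nhds 0) := by
  have h8 : Real.sqrt 8 = 2 * Real.sqrt 2 := by
    rw [show (8:ℝ) = 2 ^ 2 * 2 by norm_num, Real.sqrt_mul (by norm_num),
      Real.sqrt_sq (by norm_num)]
  have h1024 : Real.sqrt 1024 = 32 := by
    rw [show (1024:ℝ) = 32 ^ 2 by norm_num, Real.sqrt_sq (by norm_num)]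
  have hx : HasDerivAt (fun x : ℝ => x) 1 0 := hasDerivAt_id 0
  have hp : ∀ n : ℕ, HasDerivAt (fun x : ℝ => x ^ (n + 2)) 0 0 := by
    intro n
    have := hasDerivAt_pow (n + 2) (0 : ℝ)
    simpa using this
  have hr : HasDerivAt (fun x : ℝ => Real.sqrt (x ^ 2 + 8)) 0 0 := by
    have := ((hp 0).add_const 8).sqrt (by norm_num)
    simpa using this
  have hin : HasDerivAt (fun σ : ℝ => -4096 * σ ^ 6 + 78336 * σ ^ 4 + 49152 * σ ^ 2 +
      4096 * Real.sqrt (σ ^ 2 + 8) * σ + 4096 * Real.sqrt (σ ^ 2 + 8) * σ ^ 5 +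
      33280 * Real.sqrt (σ ^ 2 + 8) * σ ^ 3 + 1024) (8192 * Real.sqrt 2) 0 := by
    have := (((((((hp 4).const_mul (-4096)).add ((hp 2).const_mul 78336)).add
      ((hp 0).const_mul 49152)).add ((hr.const_mul 4096).mul hx)).add
      ((hr.const_mul 4096).mul (hp 3))).add ((hr.const_mul 33280).mul (hp 1))).add_const 1024
    refine this.congr_deriv ?_
    norm_num [h8]
    try ring
  have hs := hin.sqrt (by norm_num)
  have hF : HasDerivAt Fedge (4 * Real.sqrt 2) 0 := by
    have := ((((((hp 2).div_const 8).const_sub (1 / 2)).add ((hp 0).const_mul 4)).add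
      (hx.mul hr)).add (((hp 1).div_const 8).mul hr)).add (hs.const_mul (1 / 64))
    refine this.congr_deriv ?_
    norm_num [h8, h1024]
    try ring
  have hF0 : Fedge 0 = 1 := by
    norm_num [Fedge, h1024]
  have hG : HasDerivAt (fun x => Real.sqrt (Fedge x)) (2 * Real.sqrt 2) 0 := by
    refine (hF.sqrt (by rw [hF0]; norm_num)).congr_deriv ?_
    rw [hF0, Real.sqrt_one]
    ring
  have ht := (hasDerivAt_iff_tendsto_slope.1 hG).mono_left
    (nhdsWithin_mono (0:ℝ) (fun x (hx : x ∈ Set.Ioi (0:ℝ)) => (ne_of_gt hx : x ≠ 0)))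
  have ht2 := ht.sub_const (2 * Real.sqrt 2)
  rw [sub_self] at ht2
  refine ht2.congr' ?_
  filter_upwards [self_mem_nhdsWithin] with x hx
  have hx0 : x ≠ 0 := ne_of_gt hx
  simp only [slope_def_field, hF0, Real.sqrt_one, sub_zero]
  field_simp
end
end

section
/- As σ → ∞, √(F(σ))/σ converges to √(11/2 + 5√5/2); that is, lim_{σ→∞} √(F(σ))/σ = √(11/2 + (5/2)√5). -/
noncomputable section

def Haux (t : ℝ) : ℝ :=
  t ^ 2 / 2 + 1 / (Real.sqrt (1 + 8 * t ^ 2) + 1) + 4 + Real.sqrt (1 + 8 * t ^ 2) +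
    1 / 64 * Real.sqrt (32768 / (Real.sqrt (1 + 8 * t ^ 2) + 1) + 78336 + 49152 * t ^ 2 +
      4096 * Real.sqrt (1 + 8 * t ^ 2) * t ^ 2 + 33280 * Real.sqrt (1 + 8 * t ^ 2) + 1024 * t ^ 4)

lemma Haux_cont : Continuous Haux := by
  have h : ∀ t : ℝ, Real.sqrt (1 + 8 * t ^ 2) + 1 ≠ 0 := fun t => by positivity
  unfold Haux
  fun_prop (disch := exact h _)

lemma Haux_zero : Haux 0 = 11 / 2 + 5 * Real.sqrt 5 / 2 := by
  have h : Real.sqrt 128000 = 160 * Real.sqrt 5 := by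
    rw [show (128000 : ℝ) = 160 ^ 2 * 5 by norm_num, Real.sqrt_mul (by norm_num),
      Real.sqrt_sq (by norm_num)]
  unfold Haux
  norm_num
  rw [h]
  ring

lemma Fedge_eq (σ : ℝ) (hσ : 0 < σ) : Fedge σ = σ ^ 2 * Haux σ⁻¹ := by
  have hs : Real.sqrt (σ ^ 2 + 8) = σ * Real.sqrt (1 + 8 * σ⁻¹ ^ 2) := by
    rw [show σ ^ 2 + 8 = σ ^ 2 * (1 + 8 * σ⁻¹ ^ 2) by field_simp, Real.sqrt_mul (by positivity),
      Real.sqrt_sq hσ.le]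
  have hr : Real.sqrt (1 + 8 * σ⁻¹ ^ 2) ^ 2 = 1 + 8 * σ⁻¹ ^ 2 := Real.sq_sqrt (by positivity)
  have hr0 : 0 ≤ Real.sqrt (1 + 8 * σ⁻¹ ^ 2) := Real.sqrt_nonneg _
  unfold Fedge Haux
  rw [hs]
  generalize Real.sqrt (1 + 8 * σ⁻¹ ^ 2) = r at *
  have h1 : r + 1 ≠ 0 := by positivity
  have hσ0 := hσ.ne'
  have hk : 1 / (r + 1) = σ ^ 2 * (r - 1) / 8 := by
    have : σ ^ 2 * (r ^ 2 - 1) = 8 := by rw [hr]; field_simp; ring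
    rw [div_eq_iff h1]; linarith
  have hk2 : 32768 / (r + 1) = 4096 * σ ^ 2 * (r - 1) := by
    rw [show 32768 / (r + 1) = 32768 * (1 / (r + 1)) by ring, hk]; ring
  rw [hk, hk2]
  have hG : -4096 * σ ^ 6 + 78336 * σ ^ 4 + 49152 * σ ^ 2 + 4096 * (σ * r) * σ
      + 4096 * (σ * r) * σ ^ 5 + 33280 * (σ * r) * σ ^ 3 + 1024
      = (σ ^ 2) ^ 2 * (4096 * σ ^ 2 * (r - 1) + 78336 + 49152 * σ⁻¹ ^ 2 + 4096 * r * σ⁻¹ ^ 2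
        + 33280 * r + 1024 * σ⁻¹ ^ 4) := by
    field_simp
    ring
  rw [hG, Real.sqrt_mul (by positivity), Real.sqrt_sq (by positivity)]
  generalize Real.sqrt _ = q
  field_simp
  ring

/-- As `σ → ∞`, `√(F(σ))/σ → √(11/2 + (5/2)√5)`. -/
theorem sqrt_Fedge_asymptotics_at_infinity :
    Filter.Tendsto (fun σ : ℝ => Real.sqrt (Fedge σ) / σ) Filter.atTop
      (nhds (Real.sqrt (11 / 2 + 5 * Real.sqrt 5 / 2))) := by
  have h := (Real.continuous_sqrt.comp Haux_cont).tendsto 0 |>.comp tendsto_inv_atTop_zero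
  simp only [Function.comp_apply, Haux_zero] at h
  refine h.congr' ?_
  filter_upwards [Filter.eventually_gt_atTop 0] with σ hσ
  simp only [Function.comp_apply]
  rw [Fedge_eq σ hσ, Real.sqrt_mul (by positivity), Real.sqrt_sq hσ.le]
  field_simp
end
end

section
/- Let m ∈ ℝ, σ > 0, and let z ∈ ℝ with z > m + 2σ. Then the Stieltjes (Cauchy) transform of the shifted semicircular distribution SC_{m,σ} satisfies ∫_{m−2σ}^{m+2σ} (1/(z − x))·(√(4σ² − (x − m)²)/(2πσ²)) dx = (z − m − √((z − m)² − 4σ²))/(2σ²). -/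
noncomputable section

theorem semicircle_aux (a w : ℝ) (ha : 0 < a) (hw : a < w) :
    ∫ t in (-a)..a, (1 / (w - t)) * Real.sqrt (a ^ 2 - t ^ 2) =
      Real.pi * (w - Real.sqrt (w ^ 2 - a ^ 2)) := by
  have hRp : 0 < w ^ 2 - a ^ 2 := by nlinarith
  set R := Real.sqrt (w ^ 2 - a ^ 2) with hR
  have hR0 : 0 < R := Real.sqrt_pos.mpr hRp
  have hR2 : R ^ 2 = w ^ 2 - a ^ 2 := Real.sq_sqrt hRp.le
  have key := intervalIntegral.integral_eq_sub_of_hasDerivAt_of_le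
    (a := -a) (b := a)
    (f := fun t => -Real.sqrt (a ^ 2 - t ^ 2) + w * Real.arcsin (t / a)
      - R * Real.arcsin ((w * t - a ^ 2) / (a * (w - t))))
    (f' := fun t => (1 / (w - t)) * Real.sqrt (a ^ 2 - t ^ 2)) (by linarith) ?_ ?_ ?_
  · rw [key]
    have h1 : (w * a - a ^ 2) / (a * (w - a)) = 1 := by
      have : w - a ≠ 0 := by linarith
      field_simp
    have h2 : (w * (-a) - a ^ 2) / (a * (w - -a)) = -1 := by
      have : w - -a ≠ 0 := by linarith
      rw [div_eq_iff (by positivity)]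
      ring
    have h3 : a / a = 1 := div_self ha.ne'
    have h4 : -a / a = -1 := by rw [neg_div, h3]
    simp only [h1, h2, h3, h4, Real.arcsin_one, Real.arcsin_neg_one, neg_sq]
    ring
  · have hne : ∀ t ∈ Set.Icc (-a) a, a * (w - t) ≠ 0 := by
      intro t ht
      have : 0 < w - t := by linarith [ht.2]
      positivity
    refine ContinuousOn.sub (Continuous.continuousOn ?_) (ContinuousOn.mul continuousOn_const ?_)
    · have := Real.continuous_arcsin
      fun_prop
    · exact Real.continuous_arcsin.comp_continuousOn
        (ContinuousOn.div (by fun_prop) (by fun_prop) hne)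
  · intro t ht
    have hwt : 0 < w - t := by linarith [ht.2]
    have hsp : 0 < a ^ 2 - t ^ 2 := by nlinarith [ht.1, ht.2]
    set s := Real.sqrt (a ^ 2 - t ^ 2) with hs
    have hs0 : 0 < s := Real.sqrt_pos.mpr hsp
    have hs2 : s ^ 2 = a ^ 2 - t ^ 2 := Real.sq_sqrt hsp.le
    have e1 : Real.sqrt (1 - (t / a) ^ 2) = s / a := by
      rw [Real.sqrt_eq_iff_mul_self_eq_of_pos (by positivity)]
      field_simp
      linarith
    have q : 1 - ((w * t - a ^ 2) / (a * (w - t))) ^ 2 = (s * R / (a * (w - t))) ^ 2 := by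
      rw [div_pow, div_pow, mul_pow s R, hs2, hR2]
      field_simp
      ring
    have e2 : Real.sqrt (1 - ((w * t - a ^ 2) / (a * (w - t))) ^ 2) = s * R / (a * (w - t)) := by
      rw [q, Real.sqrt_sq (by positivity)]
    have p1 : 0 < 1 - (t / a) ^ 2 := by
      rw [← Real.sqrt_pos, e1]; positivity
    have p2 : 0 < 1 - ((w * t - a ^ 2) / (a * (w - t))) ^ 2 := by rw [q]; positivity
    have d0 : HasDerivAt (fun t : ℝ => a ^ 2 - t ^ 2) (-(2 * t)) t := by
      simpa using ((hasDerivAt_id t).pow 2).const_sub (a ^ 2)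
    have d1 := (d0.sqrt hsp.ne').neg
    have d2 := ((Real.hasDerivAt_arcsin (x := t / a) (by rintro h; rw [h] at p1; norm_num at p1)
      (by rintro h; rw [h] at p1; norm_num at p1)).comp t
      ((hasDerivAt_id t).div_const a)).const_mul w
    have du : HasDerivAt (fun t : ℝ => (w * t - a ^ 2) / (a * (w - t)))
        ((w * (a * (w - t)) - (w * t - a ^ 2) * (-a)) / (a * (w - t)) ^ 2) t := by
      refine HasDerivAt.div ?_ ?_ (by positivity)
      · simpa using ((hasDerivAt_id t).const_mul w).sub_const (a ^ 2)
      · simpa using ((hasDerivAt_id t).const_sub w).const_mul a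
    have d3 := ((Real.hasDerivAt_arcsin (x := (w * t - a ^ 2) / (a * (w - t)))
      (by rintro h; rw [h] at p2; norm_num at p2)
      (by rintro h; rw [h] at p2; norm_num at p2)).comp t du).const_mul R
    refine ((d1.add d2).sub d3).congr_deriv ?_
    rw [e1, e2, ← hs]
    have hk : w * (a * (w - t)) - (w * t - a ^ 2) * (-a) = a * R ^ 2 := by
      rw [hR2]; ring
    rw [hk]
    field_simp
    rw [hs2, hR2]
    ring
  · apply ContinuousOn.intervalIntegrable
    rw [Set.uIcc_of_le (by linarith)]
    refine ContinuousOn.mul (ContinuousOn.div (by fun_prop) (by fun_prop) ?_) (by fun_prop)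
    intro t ht
    have : 0 < w - t := by linarith [ht.2]
    exact this.ne'

/-- The Stieltjes (Cauchy) transform of the shifted semicircular distribution `SC_{m,σ}` at a
real point `z > m + 2σ` outside the support:
`∫ 1/(z - x) dSC_{m,σ}(x) = (z - m - √((z - m)² - 4σ²))/(2σ²)`. -/
theorem stieltjes_transform_shifted_semicircle (m σ z : ℝ) (hσ : 0 < σ)
    (hz : m + 2 * σ < z) :
    ∫ x in (m - 2 * σ)..(m + 2 * σ),
        (1 / (z - x)) * (Real.sqrt (4 * σ ^ 2 - (x - m) ^ 2) / (2 * Real.pi * σ ^ 2)) =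
      (z - m - Real.sqrt ((z - m) ^ 2 - 4 * σ ^ 2)) / (2 * σ ^ 2) := by
  have h := semicircle_aux (2 * σ) (z - m) (by linarith) (by linarith)
  have e : (2 * σ) ^ 2 = 4 * σ ^ 2 := by ring
  rw [e] at h
  have h' := intervalIntegral.integral_comp_sub_right (a := m - 2 * σ) (b := m + 2 * σ)
    (fun t => (1 / (z - m - t)) * Real.sqrt (4 * σ ^ 2 - t ^ 2)) m
  rw [show m - 2 * σ - m = -(2 * σ) by ring, show m + 2 * σ - m = 2 * σ by ring, h] at h'
  simp only [sub_sub_sub_cancel_right] at h'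
  simp only [← mul_div_assoc]
  rw [intervalIntegral.integral_div, h']
  have := Real.pi_pos
  field_simp
end
end
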